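/- Let λ = (λ_1 ≥ … ≥ λ_ℓ > 0) be a partition. The rational function in ζ over ℚ(q,t) given by ζ ↦ ∏_{1≤α<β≤ℓ} ∏_{i=1}^{λ_α} ∏_{j=1}^{λ_β} γ₊(q^{-i} ζ^{α}, q^{-j} ζ^{β}; q,t)^{-1} is regular at ζ = t, and its value at ζ = t equals ∏_{1≤α<β≤ℓ} [ (t^{β−α}; q)_{λ_α} · (q^{-λ_β+1} t^{β−α−1}; q)_{λ_α} ] / [ (q^{-λ_β} t^{β−α}; q)_{λ_α} · (q t^{β−α−1}; q)_{λ_α} ]. -/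

import Mathlib

noncomputable section

/-- The field ℚ(q,t) of rational functions in two independent indeterminates over ℚ. -/
abbrev K : Type := FractionRing (MvPolynomial (Fin 2) ℚ)

def q : K := algebraMap (MvPolynomial (Fin 2) ℚ) K (MvPolynomial.X 0)
def t : K := algebraMap (MvPolynomial (Fin 2) ℚ) K (MvPolynomial.X 1)

/-- The field ℚ(q,t)(ζ) of rational functions in ζ over ℚ(q,t). -/
abbrev R : Type := RatFunc K

/-- `q` as an element of ℚ(q,t)(ζ). -/
def Qv : R := RatFunc.C q
/-- `t` as an element of ℚ(q,t)(ζ). -/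
def Tv : R := RatFunc.C t
/-- the variable ζ. -/
def Zv : R := RatFunc.X

/-- The q-Pochhammer symbol `(u;q)_n = ∏_{i=0}^{n-1} (1 - qⁱ u)`. -/
def qPoch (q u : K) (n : ℕ) : K := ∏ i ∈ Finset.range n, (1 - q ^ i * u)

/-- `γ₊(z,w;q,t) = (z - q⁻¹w)(z - q t⁻¹ w)/((z - w)(z - t⁻¹ w))`. -/
def gammaPlus {F : Type*} [Field F] (q t zz ww : F) : F :=
  (zz - q⁻¹ * ww) * (zz - q * t⁻¹ * ww) / ((zz - ww) * (zz - t⁻¹ * ww))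

/-- `f` is regular at `a` with value `v`: it is a quotient `p / s` of polynomials with
`s(a) ≠ 0` and `p(a) = v * s(a)`. -/
def RegularWithValue {k : Type*} [Field k] (a : k) (f : RatFunc k) (v : k) : Prop :=
  ∃ p s : Polynomial k, s.eval a ≠ 0 ∧
    f * algebraMap (Polynomial k) (RatFunc k) s = algebraMap (Polynomial k) (RatFunc k) p ∧
    p.eval a = v * s.eval a

namespace RegularWithValue

variable {k : Type*} [Field k] {a v w : k} {f g : RatFunc k}

theorem denom_ne_zero_and_eval_eq (h : RegularWithValue a f v) :
    f.denom.eval a ≠ 0 ∧ f.eval (RingHom.id k) a = v := by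
  obtain ⟨p, s, hs, hf, hp⟩ := h
  have hs0 : s ≠ 0 := by rintro rfl; simp at hs
  have hs0' : algebraMap (Polynomial k) (RatFunc k) s ≠ 0 := by simpa using hs0
  have hfe : f = algebraMap _ _ p / algebraMap _ _ s := (eq_div_iff hs0').2 hf
  have hd : f.denom ∣ s := (RatFunc.denom_dvd hs0).2 ⟨p, hfe⟩
  have hden : f.denom.eval a ≠ 0 := by
    obtain ⟨c, rfl⟩ := hd
    rw [Polynomial.eval_mul] at hs
    exact left_ne_zero_of_mul hs
  refine ⟨hden, ?_⟩
  have hnum : f.num * s = p * f.denom := by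
    rw [← (RatFunc.algebraMap_injective k).eq_iff, map_mul, map_mul, ← hf]
    have hd0 : algebraMap (Polynomial k) (RatFunc k) f.denom ≠ 0 := by
      simpa using f.denom_ne_zero
    have := (div_eq_iff hd0).1 (RatFunc.num_div_denom f)
    rw [this]; ring
  have hev := congrArg (Polynomial.eval a) hnum
  rw [Polynomial.eval_mul, Polynomial.eval_mul, hp] at hev
  rw [RatFunc.eval, Polynomial.eval₂_id, Polynomial.eval₂_id, div_eq_iff hden]
  apply mul_right_cancel₀ hs
  rw [hev]; ring

theorem of_algebraMap (p : Polynomial k) :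
    RegularWithValue a (algebraMap (Polynomial k) (RatFunc k) p) (p.eval a) :=
  ⟨p, 1, by simp⟩

theorem mul (hf : RegularWithValue a f v) (hg : RegularWithValue a g w) :
    RegularWithValue a (f * g) (v * w) := by
  obtain ⟨p, s, hs, hf, hp⟩ := hf
  obtain ⟨p', s', hs', hg, hp'⟩ := hg
  refine ⟨p * p', s * s', by simp [hs, hs'], ?_, ?_⟩
  · rw [map_mul, map_mul, ← hf, ← hg]; ring
  · rw [Polynomial.eval_mul, Polynomial.eval_mul, hp, hp']; ring

theorem inv (hf : RegularWithValue a f v) (hv : v ≠ 0) : RegularWithValue a f⁻¹ v⁻¹ := by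
  obtain ⟨p, s, hs, hf, hp⟩ := hf
  have hp0 : p.eval a ≠ 0 := hp ▸ mul_ne_zero hv hs
  have hf0 : f ≠ 0 := by
    rintro rfl
    rw [zero_mul, eq_comm, map_eq_zero_iff _ (RatFunc.algebraMap_injective k)] at hf
    simp [hf] at hp0
  refine ⟨s, p, hp0, ?_, ?_⟩
  · rw [← hf, inv_mul_cancel_left₀ hf0]
  · rw [hp, inv_mul_cancel_left₀ hv]

theorem div (hf : RegularWithValue a f v) (hg : RegularWithValue a g w) (hw : w ≠ 0) :
    RegularWithValue a (f / g) (v / w) := by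
  simpa only [div_eq_mul_inv] using hf.mul (hg.inv hw)

theorem prod {ι : Type*} {S : Finset ι} {F : ι → RatFunc k} {V : ι → k}
    (h : ∀ i ∈ S, RegularWithValue a (F i) (V i)) :
    RegularWithValue a (∏ i ∈ S, F i) (∏ i ∈ S, V i) := by
  classical
  induction S using Finset.induction_on with
  | empty => simpa using RegularWithValue.of_algebraMap (a := a) (1 : Polynomial k)
  | insert i S hi ih =>
    rw [Finset.prod_insert hi, Finset.prod_insert hi]
    exact (h i (Finset.mem_insert_self i S)).mul
      (ih fun j hj => h j (Finset.mem_insert_of_mem hj))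

theorem one_sub_C_mul_X_pow (c : k) (n : ℕ) :
    RegularWithValue a (1 - RatFunc.C c * RatFunc.X ^ n) (1 - c * a ^ n) := by
  convert RegularWithValue.of_algebraMap (a := a) (1 - Polynomial.C c * Polynomial.X ^ n) using 1
    <;> simp

end RegularWithValue

theorem RatFunc.one_sub_C_mul_X_pow_ne_zero {k : Type*} [Field k] (c : k) {n : ℕ} (hn : n ≠ 0) :
    (1 - RatFunc.C c * RatFunc.X ^ n : RatFunc k) ≠ 0 := by
  have h : (1 - Polynomial.C c * Polynomial.X ^ n : Polynomial k) ≠ 0 := by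
    intro h
    simpa [hn] using congrArg (Polynomial.eval 0) h
  simpa using (map_ne_zero_iff _ (RatFunc.algebraMap_injective k)).2 h

theorem q_ne_zero : q ≠ 0 := by
  simp [q]

theorem t_ne_zero : t ≠ 0 := by
  simp [t]

theorem q_pow_mul_t_pow_injective {a b c d : ℕ} (h : q ^ a * t ^ b = q ^ c * t ^ d) :
    a = c ∧ b = d := by
  simp only [q, t, ← map_pow, ← map_mul] at h
  have h := IsFractionRing.injective (MvPolynomial (Fin 2) ℚ) K h
  simp only [MvPolynomial.X_pow_eq_monomial, MvPolynomial.monomial_mul] at h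
  have h := MvPolynomial.monomial_left_injective (by norm_num : (1 * 1 : ℚ) ≠ 0) h
  have h0 := DFunLike.congr_fun h 0
  have h1 := DFunLike.congr_fun h 1
  simp at h0 h1
  exact ⟨h0, h1⟩

theorem one_sub_q_zpow_mul_t_pow_ne_zero {a : ℤ} {b : ℕ} (h : a ≠ 0 ∨ b ≠ 0) :
    1 - q ^ a * t ^ b ≠ 0 := by
  intro h0
  rw [sub_eq_zero] at h0
  obtain ⟨n, rfl | rfl⟩ := a.eq_nat_or_neg
  · rw [zpow_natCast] at h0
    have := q_pow_mul_t_pow_injective (a := 0) (b := 0) (by simpa using h0)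
    lia
  · have h0 : q ^ n * t ^ 0 = q ^ 0 * t ^ b := by
      rw [zpow_neg, zpow_natCast, ← div_eq_inv_mul, eq_div_iff (pow_ne_zero _ q_ne_zero)] at h0
      simpa using h0
    have := q_pow_mul_t_pow_injective h0
    lia

theorem qPoch_eq_prod_Icc (q u : K) (n : ℕ) :
    qPoch q u n = ∏ i ∈ Finset.Icc 1 n, (1 - q ^ ((i : ℤ) - 1) * u) := by
  induction n with
  | zero => simp [qPoch]
  | succ n ih =>
    rw [Finset.prod_Icc_succ_top (by lia), ← ih, qPoch, qPoch, Finset.prod_range_succ]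
    simp

section Telescoping

variable {F : Type*} [Field F]

theorem inv_gammaPlus {q t z : F} (hq : q ≠ 0) (hz : z ≠ 0) (x : F) (i j : ℕ) :
    (gammaPlus q t (q⁻¹ ^ i * z) (q⁻¹ ^ j * (x * z)))⁻¹ =
      (1 - q ^ ((i : ℤ) - j) * x) / (1 - q ^ ((i : ℤ) - j - 1) * x) *
        ((1 - q ^ ((i : ℤ) - j) * (t⁻¹ * x)) / (1 - q ^ ((i : ℤ) - j + 1) * (t⁻¹ * x))) := by
  have hA : q⁻¹ ^ i * z ≠ 0 := by positivity
  have hj : q⁻¹ ^ j * (x * z) = q⁻¹ ^ i * z * (q ^ ((i : ℤ) - j) * x) := by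
    rw [zpow_sub₀ hq, zpow_natCast, zpow_natCast, inv_pow, inv_pow]
    field_simp
  rw [hj, zpow_sub_one₀ hq, zpow_add_one₀ hq, gammaPlus]
  generalize q⁻¹ ^ i * z = A at hA
  generalize q ^ ((i : ℤ) - j) = y
  have e₁ : A - q⁻¹ * (A * (y * x)) = A * (1 - y * q⁻¹ * x) := by ring
  have e₂ : A - q * t⁻¹ * (A * (y * x)) = A * (1 - y * q * (t⁻¹ * x)) := by ring
  have e₃ : A - A * (y * x) = A * (1 - y * x) := by ring
  have e₄ : A - t⁻¹ * (A * (y * x)) = A * (1 - y * (t⁻¹ * x)) := by ring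
  rw [e₁, e₂, e₃, e₄, inv_div, mul_mul_mul_comm, mul_mul_mul_comm A (1 - y * q⁻¹ * x),
    mul_div_mul_left _ _ (mul_ne_zero hA hA), mul_div_mul_comm]

theorem prod_Icc_div_sub_one {h : ℤ → F} (hh : ∀ k, h k ≠ 0) (i : ℤ) (n : ℕ) :
    ∏ j ∈ Finset.Icc 1 n, h (i - (j : ℤ)) / h (i - (j : ℤ) - 1) = h (i - 1) / h (i - n - 1) := by
  induction n with
  | zero => simp [hh]
  | succ n ih =>
    rw [Finset.prod_Icc_succ_top (by lia), ih,
      show i - ((n + 1 : ℕ) : ℤ) = i - n - 1 by push_cast; ring, div_mul_div_cancel₀ (hh _)]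

theorem prod_Icc_div_add_one {h : ℤ → F} (hh : ∀ k, h k ≠ 0) (i : ℤ) (n : ℕ) :
    ∏ j ∈ Finset.Icc 1 n, h (i - (j : ℤ)) / h (i - (j : ℤ) + 1) = h (i - n) / h i := by
  induction n with
  | zero => simp [hh]
  | succ n ih =>
    rw [Finset.prod_Icc_succ_top (by lia), ih,
      show i - ((n + 1 : ℕ) : ℤ) + 1 = i - n by push_cast; ring, mul_comm,
      div_mul_div_cancel₀ (hh _)]

theorem prod_inv_gammaPlus {q t z x : F} (hq : q ≠ 0) (hz : z ≠ 0)
    (hx : ∀ k : ℤ, 1 - q ^ k * x ≠ 0) (htx : ∀ k : ℤ, 1 - q ^ k * (t⁻¹ * x) ≠ 0) (i n : ℕ) :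
    ∏ j ∈ Finset.Icc 1 n, (gammaPlus q t (q⁻¹ ^ i * z) (q⁻¹ ^ j * (x * z)))⁻¹ =
      (1 - q ^ ((i : ℤ) - 1) * x) / (1 - q ^ ((i : ℤ) - n - 1) * x) *
        ((1 - q ^ ((i : ℤ) - n) * (t⁻¹ * x)) / (1 - q ^ (i : ℤ) * (t⁻¹ * x))) := by
  simp only [inv_gammaPlus hq hz, Finset.prod_mul_distrib]
  rw [prod_Icc_div_sub_one (h := fun k => 1 - q ^ k * x) hx,
    prod_Icc_div_add_one (h := fun k => 1 - q ^ k * (t⁻¹ * x)) htx]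

end Telescoping

theorem regularWithValue_prod_inv_gammaPlus (α n i m : ℕ) (hi : 1 ≤ i) :
    RegularWithValue t
      (∏ j ∈ Finset.Icc 1 m, (gammaPlus Qv Tv (Qv⁻¹ ^ i * Zv ^ α)
        (Qv⁻¹ ^ j * Zv ^ (n + 1 + α)))⁻¹)
      ((1 - q ^ ((i : ℤ) - 1) * t ^ (n + 1)) / (1 - q ^ ((i : ℤ) - m - 1) * t ^ (n + 1)) *
        ((1 - q ^ ((i : ℤ) - m) * t ^ n) / (1 - q ^ (i : ℤ) * t ^ n))) := by
  have hQ : Qv ≠ 0 := by simpa [Qv] using q_ne_zero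
  have hZ : Zv ^ α ≠ 0 := pow_ne_zero _ RatFunc.X_ne_zero
  have e₁ (k : ℤ) : 1 - Qv ^ k * Zv ^ (n + 1) =
      1 - RatFunc.C (q ^ k) * RatFunc.X ^ (n + 1) := by
    rw [Qv, Zv, map_zpow₀]
  have e₂ (k : ℤ) : 1 - Qv ^ k * (Tv⁻¹ * Zv ^ (n + 1)) =
      1 - RatFunc.C (q ^ k * t⁻¹) * RatFunc.X ^ (n + 1) := by
    rw [Qv, Tv, Zv, map_mul, map_zpow₀, map_inv₀, mul_assoc]
  have hx (k : ℤ) : 1 - Qv ^ k * Zv ^ (n + 1) ≠ 0 :=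
    e₁ k ▸ RatFunc.one_sub_C_mul_X_pow_ne_zero _ n.succ_ne_zero
  have htx (k : ℤ) : 1 - Qv ^ k * (Tv⁻¹ * Zv ^ (n + 1)) ≠ 0 :=
    e₂ k ▸ RatFunc.one_sub_C_mul_X_pow_ne_zero _ n.succ_ne_zero
  have r₁ (k : ℤ) : RegularWithValue t (1 - Qv ^ k * Zv ^ (n + 1)) (1 - q ^ k * t ^ (n + 1)) :=
    e₁ k ▸ .one_sub_C_mul_X_pow _ _
  have r₂ (k : ℤ) :
      RegularWithValue t (1 - Qv ^ k * (Tv⁻¹ * Zv ^ (n + 1))) (1 - q ^ k * t ^ n) := by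
    have h := RegularWithValue.one_sub_C_mul_X_pow (a := t) (q ^ k * t⁻¹) (n + 1)
    rwa [← e₂, mul_assoc, pow_succ' t, inv_mul_cancel_left₀ t_ne_zero] at h
  simp only [pow_add Zv (n + 1) α]
  rw [prod_inv_gammaPlus hQ hZ hx htx]
  exact ((r₁ _).div (r₁ _) (one_sub_q_zpow_mul_t_pow_ne_zero (by lia))).mul
    ((r₂ _).div (r₂ _) (one_sub_q_zpow_mul_t_pow_ne_zero (by lia)))

theorem qPoch_div_qPoch_eq_prod (n a m : ℕ) :
    (qPoch q (t ^ (n + 1)) a * qPoch q (q ^ ((1 : ℤ) - m) * t ^ n) a) /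
        (qPoch q (q ^ (-(m : ℤ)) * t ^ (n + 1)) a * qPoch q (q * t ^ n) a) =
      ∏ i ∈ Finset.Icc 1 a,
        ((1 - q ^ ((i : ℤ) - 1) * t ^ (n + 1)) / (1 - q ^ ((i : ℤ) - m - 1) * t ^ (n + 1)) *
          ((1 - q ^ ((i : ℤ) - m) * t ^ n) / (1 - q ^ (i : ℤ) * t ^ n))) := by
  simp only [qPoch_eq_prod_Icc, Finset.prod_mul_distrib, Finset.prod_div_distrib, ← mul_assoc,
    ← zpow_add₀ q_ne_zero, ← zpow_add_one₀ q_ne_zero, sub_add_cancel, sub_add_sub_cancel,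
    ← sub_eq_add_neg, sub_right_comm _ (1 : ℤ)]
  rw [mul_div_mul_comm]

/-- as a rational function of ζ,
`∏_{1≤α<β≤ℓ} ∏_{i=1}^{λ_α} ∏_{j=1}^{λ_β} γ₊(q^{-i} ζ^α, q^{-j} ζ^β; q,t)⁻¹`
is regular at ζ = t (its reduced denominator does not vanish at `t`) and its
value there is
`∏_{1≤α<β≤ℓ} (t^{β-α};q)_{λ_α} (q^{-λ_β+1} t^{β-α-1};q)_{λ_α}
  / ((q^{-λ_β} t^{β-α};q)_{λ_α} (q t^{β-α-1};q)_{λ_α})`. -/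
theorem stmt9 (l : ℕ) (lam : ℕ → ℕ)
    (hpos : ∀ α ∈ Finset.Icc 1 l, 0 < lam α)
    (hanti : ∀ α β, 1 ≤ α → α ≤ β → β ≤ l → lam β ≤ lam α) :
    Polynomial.eval t
        (∏ α ∈ Finset.Icc 1 l, ∏ β ∈ Finset.Ioc α l,
          ∏ i ∈ Finset.Icc 1 (lam α), ∏ j ∈ Finset.Icc 1 (lam β),
            (gammaPlus Qv Tv (Qv⁻¹ ^ i * Zv ^ α) (Qv⁻¹ ^ j * Zv ^ β))⁻¹).denom ≠ 0
    ∧ RatFunc.eval (RingHom.id K) t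
        (∏ α ∈ Finset.Icc 1 l, ∏ β ∈ Finset.Ioc α l,
          ∏ i ∈ Finset.Icc 1 (lam α), ∏ j ∈ Finset.Icc 1 (lam β),
            (gammaPlus Qv Tv (Qv⁻¹ ^ i * Zv ^ α) (Qv⁻¹ ^ j * Zv ^ β))⁻¹)
      = ∏ α ∈ Finset.Icc 1 l, ∏ β ∈ Finset.Ioc α l,
          (qPoch q (t ^ ((β : ℤ) - α)) (lam α) *
              qPoch q (q ^ ((1 : ℤ) - lam β) * t ^ ((β : ℤ) - α - 1)) (lam α)) /
            (qPoch q (q ^ (-(lam β : ℤ)) * t ^ ((β : ℤ) - α)) (lam α) *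
              qPoch q (q * t ^ ((β : ℤ) - α - 1)) (lam α)) := by
  apply RegularWithValue.denom_ne_zero_and_eval_eq
  refine .prod fun α _ => .prod fun β hβ => ?_
  obtain ⟨n, rfl⟩ : ∃ n, β = n + 1 + α :=
    ⟨β - α - 1, by have := Finset.mem_Ioc.1 hβ; lia⟩
  rw [show ((n + 1 + α : ℕ) : ℤ) - α = (n + 1 : ℕ) by push_cast; ring,
    show ((n + 1 : ℕ) : ℤ) - 1 = n by push_cast; ring, zpow_natCast, zpow_natCast,
    qPoch_div_qPoch_eq_prod]
  exact .prod fun i hi =>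
    regularWithValue_prod_inv_gammaPlus α n i _ (Finset.mem_Icc.1 hi).1

end
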